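/- Let K ≥ 2 be a natural number and let Ω = ZMod K * ZMod K be the free product of two copies of the cyclic group of order K, with x the generator of the first free factor and y the generator of the second. Then the commutator subgroup ⁅Ω,Ω⁆ equals the subgroup of Ω generated by the elements x^i · (y^j x y^{−j} x^{−1}) · x^{−i} for 0 ≤ i ≤ K−1 and 1 ≤ j ≤ K−1. -/

import Mathlib

/-- The generator of the first free factor of `ℤ_K * ℤ_K`. -/
def xgen (K : ℕ) : Monoid.CoprodI (fun _ : Fin 2 => Multiplicative (ZMod K)) :=
  Monoid.CoprodI.of (i := (0 : Fin 2)) (Multiplicative.ofAdd (1 : ZMod K))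

/-- The generator of the second free factor of `ℤ_K * ℤ_K`. -/
def ygen (K : ℕ) : Monoid.CoprodI (fun _ : Fin 2 => Multiplicative (ZMod K)) :=
  Monoid.CoprodI.of (i := (1 : Fin 2)) (Multiplicative.ofAdd (1 : ZMod K))

section TwoGenerators

variable {G : Type*} [Group G] {x y : G} {H : Subgroup G}

theorem pow_mul_pow_mul_inv_mem
    (h : ∀ i j : ℕ, x ^ i * (y ^ j * x * (y ^ j)⁻¹ * x⁻¹) * (x ^ i)⁻¹ ∈ H) (i j : ℕ) :
    x ^ i * y ^ j * (x ^ i)⁻¹ * (y ^ j)⁻¹ ∈ H := by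
  induction i with
  | zero => simp
  | succ i ih =>
    have key : x ^ (i + 1) * y ^ j * (x ^ (i + 1))⁻¹ * (y ^ j)⁻¹ =
        (x ^ i * (y ^ j * x * (y ^ j)⁻¹ * x⁻¹) * (x ^ i)⁻¹)⁻¹ *
          (x ^ i * y ^ j * (x ^ i)⁻¹ * (y ^ j)⁻¹) := by
      rw [pow_succ]
      group
    rw [key]
    exact H.mul_mem (H.inv_mem (h i j)) ih

theorem Subgroup.closure_normal_of_conj_mem {S T : Set G} (hT : Submonoid.closure T = ⊤)
    (h : ∀ t ∈ T, ∀ s ∈ S, t * s * t⁻¹ ∈ Subgroup.closure S) :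
    (Subgroup.closure S).Normal := by
  have hle : ∀ g : G, Subgroup.closure S ≤
      (Subgroup.closure S).comap (MulAut.conj g).toMonoidHom := by
    intro g
    have hg : g ∈ Submonoid.closure T := hT ▸ Submonoid.mem_top g
    induction hg using Submonoid.closure_induction with
    | mem t ht => exact (Subgroup.closure_le _).2 fun s hs => h t ht s hs
    | one => intro n hn; simpa using hn
    | mul a b _ _ ha hb =>
      intro n hn
      simpa using ha (hb hn)
  exact ⟨fun n hn g => hle g hn⟩

theorem commutator_le_of_generators_commute (hH : H.Normal) {T : Set G}
    (hT : Submonoid.closure T = ⊤)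
    (h : ∀ a ∈ T, ∀ b ∈ T, Commute (a : G ⧸ H) (b : G ⧸ H)) :
    commutator G ≤ H := by
  have hcomm : ∀ a b : G, Commute (a : G ⧸ H) (b : G ⧸ H) := by
    intro a b
    have ha : a ∈ Submonoid.closure T := hT ▸ Submonoid.mem_top a
    have hb : b ∈ Submonoid.closure T := hT ▸ Submonoid.mem_top b
    induction ha, hb using Submonoid.closure_induction₂ with
    | mem a b ha hb => exact h a ha b hb
    | one_left a _ => exact Commute.one_left _
    | one_right a _ => exact Commute.one_right _
    | mul_left a b c _ _ _ hac hbc => exact Commute.mul_left hac hbc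
    | mul_right a b c _ _ _ hab hac => exact Commute.mul_right hab hac
  rw [commutator_def, Subgroup.commutator_le]
  intro a _ b _
  rw [← QuotientGroup.eq_one_iff]
  exact commutatorElement_eq_one_iff_commute.2 (hcomm a b)

theorem commutator_eq_closure_of_pow_eq_one {K : ℕ} (hK : 0 < K) (hx : x ^ K = 1)
    (hy : y ^ K = 1) (hgen : Submonoid.closure {x, y} = ⊤) :
    commutator G = Subgroup.closure
      { g | ∃ i j : ℕ, i ≤ K - 1 ∧ 1 ≤ j ∧ j ≤ K - 1 ∧
          g = x ^ i * (y ^ j * x * (y ^ j)⁻¹ * x⁻¹) * (x ^ i)⁻¹ } := by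
  set S := { g | ∃ i j : ℕ, i ≤ K - 1 ∧ 1 ≤ j ∧ j ≤ K - 1 ∧
    g = x ^ i * (y ^ j * x * (y ^ j)⁻¹ * x⁻¹) * (x ^ i)⁻¹ } with hS
  have hc (i j : ℕ) :
      x ^ i * (y ^ j * x * (y ^ j)⁻¹ * x⁻¹) * (x ^ i)⁻¹ ∈ Subgroup.closure S := by
    rw [pow_eq_pow_mod i hx, pow_eq_pow_mod j hy]
    rcases Nat.eq_zero_or_pos (j % K) with hj | hj
    · simp [hj]
    · exact Subgroup.subset_closure ⟨i % K, j % K, Nat.le_sub_one_of_lt (Nat.mod_lt _ hK), hj,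
        Nat.le_sub_one_of_lt (Nat.mod_lt _ hK), rfl⟩
  have hd := pow_mul_pow_mul_inv_mem hc
  have hnormal : (Subgroup.closure S).Normal := by
    refine Subgroup.closure_normal_of_conj_mem hgen ?_
    rintro t (rfl | rfl) _ ⟨i, j, -, -, -, rfl⟩
    · convert hc (i + 1) j using 1
      rw [pow_succ']
      group
    · have hconj (i : ℕ) :
          t * (x ^ i * t ^ j * (x ^ i)⁻¹ * (t ^ j)⁻¹) * t⁻¹ ∈ Subgroup.closure S := by
        convert mul_mem (inv_mem (hd i 1)) (hd i (j + 1)) using 1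
        rw [pow_succ']
        group
      convert mul_mem (hconj i) (inv_mem (hconj (i + 1))) using 1
      rw [pow_succ x]
      group
  apply le_antisymm
  · have hxy : Commute (x : G ⧸ Subgroup.closure S) (y : G ⧸ Subgroup.closure S) := by
      rw [← commutatorElement_eq_one_iff_commute]
      exact (QuotientGroup.eq_one_iff _).2 (by simpa [commutatorElement_def] using hd 1 1)
    refine commutator_le_of_generators_commute hnormal hgen ?_
    rintro a (rfl | rfl) b (rfl | rfl)
    · exact Commute.refl _
    · exact hxy
    · exact hxy.symm
    · exact Commute.refl _
  · rw [Subgroup.closure_le]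
    rintro _ ⟨i, j, -, -, -, rfl⟩
    exact Subgroup.Normal.conj_mem inferInstance _
      (Subgroup.commutator_mem_commutator (Subgroup.mem_top (y ^ j)) (Subgroup.mem_top x)) _

end TwoGenerators

theorem xgen_pow (K n : ℕ) :
    xgen K ^ n = Monoid.CoprodI.of (i := (0 : Fin 2)) (Multiplicative.ofAdd (n : ZMod K)) := by
  rw [xgen, ← map_pow, ← ofAdd_nsmul, nsmul_one]

theorem ygen_pow (K n : ℕ) :
    ygen K ^ n = Monoid.CoprodI.of (i := (1 : Fin 2)) (Multiplicative.ofAdd (n : ZMod K)) := by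
  rw [ygen, ← map_pow, ← ofAdd_nsmul, nsmul_one]

theorem closure_xgen_ygen (K : ℕ) [NeZero K] :
    Submonoid.closure {xgen K, ygen K} = ⊤ := by
  refine eq_top_iff.2 fun g _ => ?_
  induction g using Monoid.CoprodI.induction_on with
  | one => exact one_mem _
  | of i m =>
    obtain ⟨n, hn⟩ := ZMod.natCast_zmod_surjective (Multiplicative.toAdd m)
    obtain rfl : m = Multiplicative.ofAdd (n : ZMod K) := by rw [hn]; rfl
    fin_cases i
    · exact xgen_pow K n ▸ pow_mem (Submonoid.subset_closure (by simp)) n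
    · exact ygen_pow K n ▸ pow_mem (Submonoid.subset_closure (by simp)) n
  | mul a b ha hb => exact mul_mem (ha trivial) (hb trivial)

/-- The commutator subgroup of `Ω = ℤ_K * ℤ_K` is generated by the elements
`x^i (y^j x y^{-j} x^{-1}) x^{-i}` for `0 ≤ i ≤ K-1` and `1 ≤ j ≤ K-1`. -/
theorem stmt6 (K : ℕ) (hK : 2 ≤ K) :
    commutator (Monoid.CoprodI fun _ : Fin 2 => Multiplicative (ZMod K)) =
      Subgroup.closure
        { g | ∃ i j : ℕ, i ≤ K - 1 ∧ 1 ≤ j ∧ j ≤ K - 1 ∧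
            g = xgen K ^ i *
                  (ygen K ^ j * xgen K * (ygen K ^ j)⁻¹ * (xgen K)⁻¹) *
                  (xgen K ^ i)⁻¹ } := by
  have : NeZero K := ⟨by omega⟩
  exact commutator_eq_closure_of_pow_eq_one (by omega) (by simp [xgen_pow]) (by simp [ygen_pow])
    (closure_xgen_ygen K)
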